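/- arXiv:2501.07282 — 2 statements merged into one kernel-verified Lean document; each statement's English description precedes it below -/
import Mathlib

section
/- Let G be a countable discrete amenable group, (V,‖·‖) a complete semi-normed real vector space, and π: G → Isom(V) a uniformly bounded representation. The restriction of the map S(v)(F) = Σ_{g∈F} π(g⁻¹)v to the space cl(L) of weak coboundaries is a linear isomorphism from (cl(L), ‖·‖) onto (N_⊕, |||·|||_sup), where N_⊕ = N ∩ M_⊕ is the set of additive maps ψ with |||ψ|||_G = 0. Moreover, the induced map v + cl(L) ↦ S(v) + N_⊕ is a linear isomorphism from the quotient (V/cl(L), ‖·‖_{cl(L)}) onto the quotient (M_⊕/N_⊕, |||·|||_{N_⊕}); in particular, (M_⊕/N_⊕, |||·|||_{N_⊕}) is a Banach space. -/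
open scoped Pointwise
open Filter

/-- The collection `F(G)` of non-empty finite subsets of `G`. -/
def FinG (G : Type*) := {F : Finset G // F.Nonempty}

section Defs

variable {G : Type*} [Group G] [DecidableEq G]

/-- `F` is `(K, δ)`-invariant: `|KF Δ F| ≤ δ|F|`. -/
def IsInv (K : Finset G) (δ : ℝ) (F : Finset G) : Prop :=
  ((symmDiff (K * F) F).card : ℝ) ≤ δ * (F.card : ℝ)

/-- `G` is amenable: for every `(K, δ)` there is a `(K, δ)`-invariant nonempty finite set. -/
def AmenableG (G : Type*) [Group G] [DecidableEq G] : Prop :=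
  ∀ K : Finset G, K.Nonempty → ∀ δ : ℝ, 0 < δ →
    ∃ F : Finset G, F.Nonempty ∧ IsInv K δ F

/-- `limsup_{F → G} φ(F) = inf_{(K,δ)} sup {φ(F) : F is (K,δ)-invariant}` (in the extended reals). -/
noncomputable def limsupG (φ : FinG G → ℝ) : EReal :=
  ⨅ (K : {K : Finset G // K.Nonempty}) (δ : {d : ℝ // 0 < d}),
    ⨆ F : {F : FinG G // IsInv K.1 δ.1 F.1}, (φ F.1 : EReal)

/-- `liminf_{F → G} φ(F) = sup_{(K,δ)} inf {φ(F) : F is (K,δ)-invariant}` (in the extended reals). -/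
noncomputable def liminfG (φ : FinG G → ℝ) : EReal :=
  ⨆ (K : {K : Finset G // K.Nonempty}) (δ : {d : ℝ // 0 < d}),
    ⨅ F : {F : FinG G // IsInv K.1 δ.1 F.1}, (φ F.1 : EReal)

/-- `lim_{F → G} φ(F) = L`. -/
def TendstoG (φ : FinG G → ℝ) (L : ℝ) : Prop :=
  ∀ ε : ℝ, 0 < ε → ∃ (K : Finset G) (δ : ℝ), K.Nonempty ∧ 0 < δ ∧
    ∀ F : FinG G, IsInv K δ F.1 → |φ F - L| < ε

/-- A (left) Følner sequence: `|F_n Δ g F_n| / |F_n| → 0` for every `g ∈ G`. -/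
def FolnerSeq (F : ℕ → FinG G) : Prop :=
  ∀ g : G, Filter.Tendsto
    (fun n => ((symmDiff ((F n).1.image (fun h => g * h)) (F n).1).card : ℝ) / ((F n).1.card : ℝ))
    Filter.atTop (nhds (0 : ℝ))

variable {V : Type*} [SeminormedAddCommGroup V] [NormedSpace ℝ V]

/-- The representation `π` is uniformly bounded with constant `C`. -/
def UnifBdd (π : G →* (V ≃L[ℝ] V)) (C : ℝ) : Prop :=
  ∀ (g : G) (v : V), ‖π g v‖ ≤ C * ‖v‖

/-- The representation `π` is isometric (`C_π = 1`). -/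
def IsIsometric (π : G →* (V ≃L[ℝ] V)) : Prop :=
  ∀ (g : G) (v : V), ‖π g v‖ = ‖v‖

/-- The ergodic sum `S_F v = Σ_{g ∈ F} π(g⁻¹) v`. -/
noncomputable def SF (π : G →* (V ≃L[ℝ] V)) (F : Finset G) (v : V) : V :=
  ∑ g ∈ F, π g⁻¹ v

/-- The ergodic average `A_F v = |F|⁻¹ • S_F v`. -/
noncomputable def AF (π : G →* (V ≃L[ℝ] V)) (F : Finset G) (v : V) : V :=
  (F.card : ℝ)⁻¹ • SF π F v

/-- Right translation `g • F = F g⁻¹` on nonempty finite subsets. -/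
def rT (g : G) (F : FinG G) : FinG G :=
  ⟨F.1.image (fun h => h * g⁻¹), F.2.image (fun h => h * g⁻¹)⟩

/-- `G`-equivariance of a set map: `π(g) φ(F) = φ(F g⁻¹)`. -/
def IsEquivariant (π : G →* (V ≃L[ℝ] V)) (φ : FinG G → V) : Prop :=
  ∀ (g : G) (F : FinG G), π g (φ F) = φ (rT g F)

/-- Boundedness of a set map: `sup_F ‖φ(F)‖/|F| < ∞`. -/
def IsBddMap (φ : FinG G → V) : Prop :=
  ∃ C : ℝ, ∀ F : FinG G, ‖φ F‖ ≤ C * (F.1.card : ℝ)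

/-- Membership in the space `M` of bounded `G`-equivariant set maps. -/
def MemM (π : G →* (V ≃L[ℝ] V)) (φ : FinG G → V) : Prop :=
  IsBddMap φ ∧ IsEquivariant π φ

/-- The sup seminorm `|||φ|||_sup = sup_F ‖φ(F)‖/|F|`. -/
noncomputable def supNorm (φ : FinG G → V) : ℝ :=
  ⨆ F : FinG G, ‖φ F‖ / (F.1.card : ℝ)

/-- The asymptotic seminorm `|||φ|||_G = limsup_{F → G} ‖φ(F)‖/|F|` (in the extended reals). -/
noncomputable def normG (φ : FinG G → V) : EReal :=
  limsupG (fun F => ‖φ F‖ / (F.1.card : ℝ))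

/-- Union of nonempty finite subsets. -/
def unionF (E F : FinG G) : FinG G :=
  ⟨E.1 ∪ F.1, E.2.inl⟩

/-- Additive set maps: `φ(E ⊔ F) = φ(E) + φ(F)` for disjoint `E, F`. -/
def IsAdditiveMap (φ : FinG G → V) : Prop :=
  ∀ E F : FinG G, Disjoint E.1 F.1 → φ (unionF E F) = φ E + φ F

/-- The additive set map `S(v)(F) = S_F v`. -/
noncomputable def Smap (π : G →* (V ≃L[ℝ] V)) (v : V) : FinG G → V :=
  fun F => SF π F.1 v

/-- The coboundary subspace `L_W = span{w − π(g)w : w ∈ W, g ∈ G}`. -/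
def cobSpan (π : G →* (V ≃L[ℝ] V)) (W : Set V) : Submodule ℝ V :=
  Submodule.span ℝ {x | ∃ w ∈ W, ∃ g : G, x = w - π g w}

/-- The coboundary subspace `L = L_V`. -/
def cobL (π : G →* (V ≃L[ℝ] V)) : Submodule ℝ V :=
  cobSpan π Set.univ

/-- The quotient seminorm `‖v + U‖_U = inf_{u ∈ U} ‖v + u‖`. -/
noncomputable def qnorm (U : Set V) (v : V) : ℝ :=
  ⨅ u : U, ‖v + u.1‖

/-- `v` is an additive realization of `φ`: `lim_{F→G} ‖φ(F)/|F| − A_F v‖ = 0`. -/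
def IsRealization (π : G →* (V ≃L[ℝ] V)) (φ : FinG G → V) (v : V) : Prop :=
  TendstoG (fun F => ‖(F.1.card : ℝ)⁻¹ • φ F - AF π F.1 v‖) 0

/-- `φ` is asymptotically additive: `inf_{ψ ∈ M_⊕} |||φ − ψ|||_G = 0`. -/
def AsympAdd (π : G →* (V ≃L[ℝ] V)) (φ : FinG G → V) : Prop :=
  (⨅ ψ : {ψ : FinG G → V // MemM π ψ ∧ IsAdditiveMap ψ}, normG (φ - ψ.1)) = (0 : EReal)

/-- `φ` is asymptotically additive relative to `W`. -/
def AsympAddRel (π : G →* (V ≃L[ℝ] V)) (W : Set V) (φ : FinG G → V) : Prop :=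
  (⨅ w : W, limsupG (fun F => ‖(F.1.card : ℝ)⁻¹ • φ F - AF π F.1 w.1‖)) = (0 : EReal)

/-- The quotient norm on `M_⊕ / N_⊕`. -/
noncomputable def qMplusN (π : G →* (V ≃L[ℝ] V)) (ψ : FinG G → V) : ℝ :=
  ⨅ η : {η : FinG G → V // MemM π η ∧ IsAdditiveMap η ∧ normG η = (0 : EReal)},
    supNorm (ψ + η.1)

end Defs

section ErgodicSums

set_option linter.unusedSectionVars false

variable {G : Type*} [Group G] [DecidableEq G]

instance FinG.instNonempty : Nonempty (FinG G) := ⟨⟨{1}, Finset.singleton_nonempty 1⟩⟩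

lemma FinG.card_pos (F : FinG G) : (0 : ℝ) < (F.1.card : ℝ) := by
  exact_mod_cast Finset.card_pos.mpr F.2

/-- Invariance improves when `K` grows and `δ` shrinks, provided the smaller `K` contains `1`. -/
lemma IsInv.mono {K K' F : Finset G} {δ δ' : ℝ} (h1 : 1 ∈ K) (hK : K ⊆ K') (hδ : δ' ≤ δ)
    (h : IsInv K' δ' F) : IsInv K δ F := by
  have hF : F ⊆ K * F := fun x hx => Finset.mem_mul.mpr ⟨1, h1, x, hx, one_mul x⟩
  have hsub : symmDiff (K * F) F ⊆ symmDiff (K' * F) F := by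
    intro x hx
    rw [Finset.mem_symmDiff] at hx ⊢
    rcases hx with ⟨hx, hxF⟩ | ⟨hx, hxF⟩
    · exact Or.inl ⟨Finset.mul_subset_mul_right hK hx, hxF⟩
    · exact absurd (hF hx) hxF
  have hcard : ((symmDiff (K * F) F).card : ℝ) ≤ (symmDiff (K' * F) F).card := by
    exact_mod_cast Finset.card_le_card hsub
  unfold IsInv at *
  exact hcard.trans (h.trans (mul_le_mul_of_nonneg_right hδ (Nat.cast_nonneg _)))

/-- If `F` is `({1, k}, δ)`-invariant, then `|kF \ F| ≤ δ|F|`. -/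
lemma IsInv.card_sdiff_image_le {k : G} {F : Finset G} {δ : ℝ} (h : IsInv {1, k} δ F) :
    ((F.image (k * ·) \ F).card : ℝ) ≤ δ * F.card := by
  refine le_trans ?_ h
  norm_cast
  refine Finset.card_le_card fun x hx => ?_
  rw [Finset.mem_sdiff, Finset.mem_image] at hx
  obtain ⟨⟨y, hy, rfl⟩, hx⟩ := hx
  rw [Finset.mem_symmDiff]
  exact Or.inl ⟨Finset.mem_mul.mpr ⟨k, by simp, y, hy, rfl⟩, hx⟩

variable {V : Type*} [SeminormedAddCommGroup V] [NormedSpace ℝ V]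

lemma rep_one_apply (π : G →* (V ≃L[ℝ] V)) (v : V) : π 1 v = v := by
  rw [map_one]
  rfl

lemma rep_mul_apply (π : G →* (V ≃L[ℝ] V)) (g h : G) (v : V) : π (g * h) v = π g (π h v) := by
  rw [map_mul]
  rfl

lemma SF_add (π : G →* (V ≃L[ℝ] V)) (F : Finset G) (v w : V) :
    SF π F (v + w) = SF π F v + SF π F w := by
  simp [SF, Finset.sum_add_distrib]

lemma SF_sub (π : G →* (V ≃L[ℝ] V)) (F : Finset G) (v w : V) :
    SF π F (v - w) = SF π F v - SF π F w := by
  simp [SF, Finset.sum_sub_distrib]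

lemma SF_smul (π : G →* (V ≃L[ℝ] V)) (F : Finset G) (c : ℝ) (v : V) :
    SF π F (c • v) = c • SF π F v := by
  simp [SF, Finset.smul_sum]

lemma Smap_add (π : G →* (V ≃L[ℝ] V)) (v w : V) : Smap π (v + w) = Smap π v + Smap π w :=
  funext fun F => SF_add π F.1 v w

lemma Smap_sub (π : G →* (V ≃L[ℝ] V)) (v w : V) : Smap π (v - w) = Smap π v - Smap π w :=
  funext fun F => SF_sub π F.1 v w

lemma SF_singleton_one (π : G →* (V ≃L[ℝ] V)) (v : V) : SF π {1} v = v := by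
  rw [SF, Finset.sum_singleton, inv_one, rep_one_apply]

lemma norm_SF_le {π : G →* (V ≃L[ℝ] V)} {C : ℝ} (hπ : UnifBdd π C) (F : Finset G) (v : V) :
    ‖SF π F v‖ ≤ C * ‖v‖ * F.card := by
  refine (norm_sum_le_of_le F fun g _ => hπ g⁻¹ v).trans_eq ?_
  simp [mul_comm]

lemma SF_image_mul_left (π : G →* (V ≃L[ℝ] V)) (F : Finset G) (k : G) (v : V) :
    SF π (F.image (k * ·)) v = SF π F (π k⁻¹ v) := by
  unfold SF
  rw [Finset.sum_image (fun a _ b _ h => mul_left_cancel h)]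
  simp only [mul_inv_rev, rep_mul_apply]

lemma isEquivariant_Smap (π : G →* (V ≃L[ℝ] V)) (v : V) : IsEquivariant π (Smap π v) := by
  intro g F
  simp only [Smap, rT, SF]
  rw [Finset.sum_image (fun a _ b _ h => mul_right_cancel h), map_sum]
  simp only [mul_inv_rev, inv_inv, rep_mul_apply]

lemma isAdditiveMap_Smap (π : G →* (V ≃L[ℝ] V)) (v : V) : IsAdditiveMap (Smap π v) :=
  fun _ _ h => Finset.sum_union h

lemma memM_Smap {π : G →* (V ≃L[ℝ] V)} {C : ℝ} (hπ : UnifBdd π C) (v : V) :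
    MemM π (Smap π v) :=
  ⟨⟨C * ‖v‖, fun F => norm_SF_le hπ F.1 v⟩, isEquivariant_Smap π v⟩

/-- An equivariant additive set map is determined by its value at `{1}`. -/
lemma Smap_apply_one_eq {π : G →* (V ≃L[ℝ] V)} {ψ : FinG G → V} (he : IsEquivariant π ψ)
    (ha : IsAdditiveMap ψ) : Smap π (ψ ⟨{1}, Finset.singleton_nonempty 1⟩) = ψ := by
  have hsing : ∀ g : G, π g⁻¹ (ψ ⟨{1}, Finset.singleton_nonempty 1⟩) =
      ψ ⟨{g}, Finset.singleton_nonempty g⟩ := by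
    intro g
    exact (he _ _).trans (congrArg ψ (Subtype.ext (by simp [rT])))
  funext ⟨F, hF⟩
  induction hF using Finset.Nonempty.cons_induction with
  | singleton a => simpa [Smap, SF] using hsing a
  | cons a s has hs ih =>
    have hdisj : Disjoint ({a} : Finset G) s := Finset.disjoint_singleton_left.mpr has
    have hadd := ha ⟨{a}, Finset.singleton_nonempty a⟩ ⟨s, hs⟩ hdisj
    have hunion : unionF ⟨{a}, Finset.singleton_nonempty a⟩ ⟨s, hs⟩ =
        (⟨Finset.cons a s has, Finset.cons_nonempty has⟩ : FinG G) :=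
      Subtype.ext (Finset.cons_eq_insert a s has).symm
    rw [hunion] at hadd
    rw [hadd, ← ih, ← hsing a]
    exact Finset.sum_cons has

lemma supNorm_nonneg (φ : FinG G → V) : 0 ≤ supNorm φ :=
  Real.iSup_nonneg fun _ => by positivity

lemma supNorm_le {φ : FinG G → V} {c : ℝ} (h : ∀ F : FinG G, ‖φ F‖ ≤ c * F.1.card) :
    supNorm φ ≤ c :=
  ciSup_le fun F => (div_le_iff₀ F.card_pos).mpr (h F)

lemma supNorm_Smap_le {π : G →* (V ≃L[ℝ] V)} {C : ℝ} (hπ : UnifBdd π C) (v : V) :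
    supNorm (Smap π v) ≤ C * ‖v‖ :=
  supNorm_le fun F => norm_SF_le hπ F.1 v

lemma norm_apply_one_le_supNorm {φ : FinG G → V} (h : IsBddMap φ) :
    ‖φ ⟨{1}, Finset.singleton_nonempty 1⟩‖ ≤ supNorm φ := by
  obtain ⟨c, hc⟩ := h
  have hbdd : BddAbove (Set.range fun F : FinG G => ‖φ F‖ / (F.1.card : ℝ)) := by
    refine ⟨c, ?_⟩
    rintro _ ⟨F, rfl⟩
    exact (div_le_iff₀ F.card_pos).mpr (hc F)
  refine le_trans ?_ (le_ciSup hbdd ⟨{1}, Finset.singleton_nonempty 1⟩)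
  simp

/-- Averages over sufficiently invariant sets of a coboundary are uniformly small. -/
lemma exists_norm_SF_le_of_mem_cobL {π : G →* (V ≃L[ℝ] V)} {C : ℝ} (hπ : UnifBdd π C)
    {x : V} (hx : x ∈ cobL π) :
    ∀ ε : ℝ, 0 < ε → ∃ (K : Finset G) (δ : ℝ), 1 ∈ K ∧ 0 < δ ∧
      ∀ F : Finset G, IsInv K δ F → ‖SF π F x‖ ≤ ε * F.card := by
  refine Submodule.span_induction ?_ ?_ ?_ ?_ hx
  · rintro _ ⟨w, -, k, rfl⟩ ε hε
    refine ⟨{1, k⁻¹}, ε / (2 * (|C| * ‖w‖) + 1), by simp, by positivity, fun F hF => ?_⟩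
    have hbd : ∀ A : Finset G, ‖SF π A w‖ ≤ |C| * ‖w‖ * A.card := fun A =>
      (norm_SF_le hπ A w).trans (by gcongr; exact le_abs_self C)
    have hsplit : SF π F (w - π k w) =
        SF π (F \ F.image (k⁻¹ * ·)) w - SF π (F.image (k⁻¹ * ·) \ F) w := by
      rw [SF_sub, ← inv_inv k, ← SF_image_mul_left, inv_inv]
      exact (Finset.sum_sdiff_sub_sum_sdiff (f := fun g => π g⁻¹ w)).symm
    have hc1 := hF.card_sdiff_image_le
    have hc2 : (F \ F.image (k⁻¹ * ·)).card = (F.image (k⁻¹ * ·) \ F).card :=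
      Finset.card_sdiff_comm
        (Finset.card_image_of_injective _ (mul_right_injective k⁻¹)).symm
    rw [hsplit]
    calc _ ≤ |C| * ‖w‖ * (F \ F.image (k⁻¹ * ·)).card
          + |C| * ‖w‖ * (F.image (k⁻¹ * ·) \ F).card :=
          (norm_sub_le _ _).trans (add_le_add (hbd _) (hbd _))
      _ = 2 * (|C| * ‖w‖) * (F.image (k⁻¹ * ·) \ F).card := by rw [hc2]; ring
      _ ≤ (2 * (|C| * ‖w‖) + 1) * (F.image (k⁻¹ * ·) \ F).card := by gcongr; linarith
      _ ≤ (2 * (|C| * ‖w‖) + 1) * (ε / (2 * (|C| * ‖w‖) + 1) * F.card) := by gcongr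
      _ = ε * F.card := by field_simp
  · intro ε hε
    refine ⟨{1}, 1, by simp, one_pos, fun F _ => ?_⟩
    rw [SF, Finset.sum_eq_zero fun g _ => map_zero (π g⁻¹), norm_zero]
    positivity
  · intro x y _ _ hx hy ε hε
    obtain ⟨K₁, δ₁, h1, hδ₁, H₁⟩ := hx (ε / 2) (half_pos hε)
    obtain ⟨K₂, δ₂, h2, hδ₂, H₂⟩ := hy (ε / 2) (half_pos hε)
    refine ⟨K₁ ∪ K₂, min δ₁ δ₂, Finset.mem_union_left _ h1, lt_min hδ₁ hδ₂, fun F hF => ?_⟩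
    rw [SF_add]
    have e1 := H₁ F (hF.mono h1 Finset.subset_union_left (min_le_left _ _))
    have e2 := H₂ F (hF.mono h2 Finset.subset_union_right (min_le_right _ _))
    linarith [norm_add_le (SF π F x) (SF π F y)]
  · intro a x _ hx ε hε
    obtain ⟨K, δ, h1, hδ, H⟩ := hx (ε / (|a| + 1)) (by positivity)
    refine ⟨K, δ, h1, hδ, fun F hF => ?_⟩
    rw [SF_smul, norm_smul, Real.norm_eq_abs]
    calc |a| * ‖SF π F x‖ ≤ (|a| + 1) * (ε / (|a| + 1) * F.card) := by
          gcongr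
          · linarith
          · exact H F hF
      _ = ε * F.card := by field_simp

/-- Averages over sufficiently invariant sets of an element of `cl(L)` are uniformly small. -/
lemma exists_norm_SF_le_of_mem_closure {π : G →* (V ≃L[ℝ] V)} {C : ℝ} (hπ : UnifBdd π C)
    {u : V} (hu : u ∈ closure (cobL π : Set V)) :
    ∀ ε : ℝ, 0 < ε → ∃ (K : Finset G) (δ : ℝ), 1 ∈ K ∧ 0 < δ ∧
      ∀ F : Finset G, IsInv K δ F → ‖SF π F u‖ ≤ ε * F.card := by
  intro ε hε
  obtain ⟨x, hx, hux⟩ := Metric.mem_closure_iff.mp hu (ε / 2 / (|C| + 1)) (by positivity)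
  obtain ⟨K, δ, h1, hδ, H⟩ := exists_norm_SF_le_of_mem_cobL hπ hx (ε / 2) (half_pos hε)
  refine ⟨K, δ, h1, hδ, fun F hF => ?_⟩
  rw [dist_eq_norm] at hux
  have hsmall : C * ‖u - x‖ ≤ ε / 2 :=
    calc C * ‖u - x‖ ≤ (|C| + 1) * (ε / 2 / (|C| + 1)) := by
          gcongr
          linarith [le_abs_self C]
      _ = ε / 2 := by field_simp
  have e1 : ‖SF π F (u - x)‖ ≤ ε / 2 * F.card :=
    (norm_SF_le hπ F _).trans (mul_le_mul_of_nonneg_right hsmall (Nat.cast_nonneg _))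
  have e2 := H F hF
  have e3 : SF π F u = SF π F (u - x) + SF π F x := by rw [← SF_add, sub_add_cancel]
  rw [e3]
  linarith [norm_add_le (SF π F (u - x)) (SF π F x)]

lemma normG_nonneg (hG : AmenableG G) (φ : FinG G → V) : 0 ≤ normG φ := by
  refine le_iInf fun K => le_iInf fun δ => ?_
  obtain ⟨F, hF, hinv⟩ := hG K.1 K.2 δ.1 δ.2
  refine le_trans ?_ (le_iSup (fun F : {F : FinG G // IsInv K.1 δ.1 F.1} =>
    ((‖φ F.1‖ / (F.1.1.card : ℝ) : ℝ) : EReal)) ⟨⟨F, hF⟩, hinv⟩)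
  exact_mod_cast div_nonneg (norm_nonneg _) (Nat.cast_nonneg _)

lemma normG_Smap_eq_zero (hG : AmenableG G) {π : G →* (V ≃L[ℝ] V)} {C : ℝ} (hπ : UnifBdd π C)
    {u : V} (hu : u ∈ closure (cobL π : Set V)) : normG (Smap π u) = (0 : EReal) := by
  refine le_antisymm (EReal.le_of_forall_lt_iff_le.mp fun ε hε => ?_) (normG_nonneg hG _)
  obtain ⟨K, δ, h1, hδ, H⟩ := exists_norm_SF_le_of_mem_closure hπ hu ε (by exact_mod_cast hε)
  refine iInf₂_le_of_le ⟨K, 1, h1⟩ ⟨δ, hδ⟩ (iSup_le fun F => ?_)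
  exact_mod_cast (div_le_iff₀ F.1.card_pos).mpr (H F.1.1 F.2)

lemma sub_AF_mem_cobL (π : G →* (V ≃L[ℝ] V)) {F : Finset G} (hF : F.Nonempty) (v : V) :
    v - AF π F v ∈ cobL π := by
  have hne : (F.card : ℝ) ≠ 0 := by exact_mod_cast hF.card_pos.ne'
  have heq : v - AF π F v = (F.card : ℝ)⁻¹ • ∑ g ∈ F, (v - π g⁻¹ v) := by
    rw [Finset.sum_sub_distrib, smul_sub, Finset.sum_const, ← Nat.cast_smul_eq_nsmul ℝ,
      inv_smul_smul₀ hne, AF, SF]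
  rw [heq]
  exact Submodule.smul_mem _ _ (Submodule.sum_mem _ fun g _ =>
    Submodule.subset_span ⟨v, Set.mem_univ v, g⁻¹, rfl⟩)

lemma mem_closure_of_normG_Smap_eq_zero (hG : AmenableG G) {π : G →* (V ≃L[ℝ] V)} {v : V}
    (h : normG (Smap π v) = (0 : EReal)) : v ∈ closure (cobL π : Set V) := by
  refine Metric.mem_closure_iff.mpr fun ε hε => ?_
  have hlt : normG (Smap π v) < (ε : EReal) := by rw [h]; exact_mod_cast hε
  obtain ⟨K, hK⟩ := iInf_lt_iff.mp hlt
  obtain ⟨δ, hδ⟩ := iInf_lt_iff.mp hK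
  obtain ⟨F, hF, hinv⟩ := hG K.1 K.2 δ.1 δ.2
  refine ⟨v - AF π F v, sub_AF_mem_cobL π hF v, ?_⟩
  have hle := (le_iSup (fun F : {F : FinG G // IsInv K.1 δ.1 F.1} =>
    ((‖Smap π v F.1‖ / (F.1.1.card : ℝ) : ℝ) : EReal)) ⟨⟨F, hF⟩, hinv⟩).trans_lt hδ
  have hlt' : ‖SF π F v‖ / (F.card : ℝ) < ε := by exact_mod_cast hle
  rw [dist_eq_norm, sub_sub_cancel, AF, norm_smul, norm_inv, Real.norm_natCast, mul_comm,
    ← div_eq_mul_inv]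
  exact hlt'

lemma qnorm_closure_eq (L : Submodule ℝ V) (v : V) :
    qnorm (closure (L : Set V)) v = ‖(Submodule.Quotient.mk v : V ⧸ L.topologicalClosure)‖ := by
  refine Eq.trans ?_ (quotient_norm_mk_eq L.topologicalClosure.toAddSubgroup v).symm
  rw [sInf_image', qnorm]
  rfl

lemma qnorm_closure_eq_zero_iff (L : Submodule ℝ V) (v : V) :
    qnorm (closure (L : Set V)) v = 0 ↔ v ∈ closure (L : Set V) := by
  rw [qnorm_closure_eq]
  refine (QuotientAddGroup.norm_mk_eq_zero_iff_mem_closure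
    (S := L.topologicalClosure.toAddSubgroup)).trans ?_
  change v ∈ closure (closure (L : Set V)) ↔ _
  rw [closure_closure]

lemma qMplusN_nonneg (π : G →* (V ≃L[ℝ] V)) (ψ : FinG G → V) : 0 ≤ qMplusN π ψ :=
  Real.iInf_nonneg fun _ => supNorm_nonneg _

lemma qMplusN_le (π : G →* (V ≃L[ℝ] V)) (ψ : FinG G → V) {η : FinG G → V}
    (hη : MemM π η ∧ IsAdditiveMap η ∧ normG η = (0 : EReal)) :
    qMplusN π ψ ≤ supNorm (ψ + η) :=
  ciInf_le ⟨0, by rintro _ ⟨η, rfl⟩; exact supNorm_nonneg _⟩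
    (⟨η, hη⟩ : {η : FinG G → V // MemM π η ∧ IsAdditiveMap η ∧ normG η = (0 : EReal)})

lemma qMplusN_Smap_le (hG : AmenableG G) {π : G →* (V ≃L[ℝ] V)} {C : ℝ} (hπ : UnifBdd π C)
    (v : V) : qMplusN π (Smap π v) ≤ C * qnorm (closure (cobL π : Set V)) v := by
  have hle : ∀ u : (closure (cobL π : Set V) : Set V), qMplusN π (Smap π v) ≤ C * ‖v + u.1‖ := by
    intro u
    refine (qMplusN_le π _ ⟨memM_Smap hπ u.1, isAdditiveMap_Smap π u.1,
      normG_Smap_eq_zero hG hπ u.2⟩).trans ?_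
    rw [← Smap_add]
    exact supNorm_Smap_le hπ _
  have : Nonempty (closure (cobL π : Set V) : Set V) :=
    ⟨⟨0, subset_closure (zero_mem (cobL π))⟩⟩
  rcases le_or_gt 0 C with hC | hC
  · rw [qnorm, Real.mul_iInf_of_nonneg hC]
    exact le_ciInf hle
  · have hzero : ∀ w : V, ‖w‖ = 0 := fun w => by
      have h1 : ‖w‖ ≤ C * ‖w‖ := by simpa only [rep_one_apply] using hπ 1 w
      nlinarith [norm_nonneg w]
    simpa [qnorm, hzero] using hle ⟨0, subset_closure (zero_mem (cobL π))⟩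

lemma qnorm_le_qMplusN_Smap (hG : AmenableG G) {π : G →* (V ≃L[ℝ] V)} {C : ℝ}
    (hπ : UnifBdd π C) (v : V) :
    qnorm (closure (cobL π : Set V)) v ≤ qMplusN π (Smap π v) := by
  have : Nonempty {η : FinG G → V // MemM π η ∧ IsAdditiveMap η ∧ normG η = (0 : EReal)} :=
    ⟨⟨Smap π 0, memM_Smap hπ 0, isAdditiveMap_Smap π 0,
      normG_Smap_eq_zero hG hπ (subset_closure (zero_mem (cobL π)))⟩⟩
  refine le_ciInf fun ⟨η, hM, hA, hN⟩ => ?_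
  have hη := Smap_apply_one_eq hM.2 hA
  set u := η ⟨{1}, Finset.singleton_nonempty 1⟩ with hu
  have hmem : u ∈ closure (cobL π : Set V) :=
    mem_closure_of_normG_Smap_eq_zero hG (hη.symm ▸ hN)
  calc qnorm (closure (cobL π : Set V)) v ≤ ‖v + u‖ :=
        ciInf_le ⟨0, by rintro _ ⟨w, rfl⟩; exact norm_nonneg _⟩
          (⟨u, hmem⟩ : (closure (cobL π : Set V) : Set V))
    _ = ‖Smap π (v + u) ⟨{1}, Finset.singleton_nonempty 1⟩‖ :=
        congrArg norm (SF_singleton_one π (v + u)).symm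
    _ ≤ supNorm (Smap π (v + u)) := norm_apply_one_le_supNorm (memM_Smap hπ _).1
    _ = supNorm (Smap π v + η) := by rw [Smap_add, hη]

lemma qMplusN_Smap_eq_zero_iff (hG : AmenableG G) {π : G →* (V ≃L[ℝ] V)} {C : ℝ}
    (hπ : UnifBdd π C) (v : V) :
    qMplusN π (Smap π v) = 0 ↔ v ∈ closure (cobL π : Set V) := by
  rw [← qnorm_closure_eq_zero_iff]
  constructor
  · intro h
    refine le_antisymm (h ▸ qnorm_le_qMplusN_Smap hG hπ v) ?_
    rw [qnorm_closure_eq]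
    exact norm_nonneg _
  · intro h
    refine le_antisymm ?_ (qMplusN_nonneg π _)
    simpa [h] using qMplusN_Smap_le hG hπ v

/-- The quotient `M_⊕ / N_⊕` is complete. -/
lemma exists_tendsto_qMplusN [CompleteSpace V] (hG : AmenableG G) {π : G →* (V ≃L[ℝ] V)} {C : ℝ}
    (hπ : UnifBdd π C) (v : ℕ → V)
    (hv : ∀ ε : ℝ, 0 < ε → ∃ N : ℕ, ∀ m ≥ N, ∀ n ≥ N,
      qMplusN π (Smap π (v m) - Smap π (v n)) < ε) :
    ∃ w : V, Tendsto (fun n => qMplusN π (Smap π (v n) - Smap π w)) atTop (nhds (0 : ℝ)) := by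
  have hcauchy : CauchySeq fun n =>
      (Submodule.Quotient.mk (v n) : V ⧸ (cobL π).topologicalClosure) := by
    refine Metric.cauchySeq_iff.mpr fun ε hε => ?_
    obtain ⟨N, hN⟩ := hv ε hε
    refine ⟨N, fun m hm n hn => ?_⟩
    rw [dist_eq_norm, ← Submodule.Quotient.mk_sub, ← qnorm_closure_eq]
    refine (qnorm_le_qMplusN_Smap hG hπ _).trans_lt ?_
    rw [Smap_sub]
    exact hN m hm n hn
  obtain ⟨q, hq⟩ := cauchySeq_tendsto_of_complete hcauchy
  obtain ⟨w, rfl⟩ := Submodule.Quotient.mk_surjective _ q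
  refine ⟨w, squeeze_zero (fun n => qMplusN_nonneg π _) (fun n => ?_)
    (by simpa using (tendsto_iff_norm_sub_tendsto_zero.mp hq).const_mul C)⟩
  rw [← Smap_sub, ← Submodule.Quotient.mk_sub, ← qnorm_closure_eq]
  exact qMplusN_Smap_le hG hπ _

end ErgodicSums

theorem statement13 {G : Type*} [Group G] [DecidableEq G] [Countable G]
    {V : Type*} [SeminormedAddCommGroup V] [NormedSpace ℝ V] [CompleteSpace V]
    (hG : AmenableG G) (π : G →* (V ≃L[ℝ] V)) (C : ℝ) (hπ : UnifBdd π C) :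
    -- the restriction of `S` maps `cl(L)` into `N_⊕ = N ∩ M_⊕`:
    (∀ u ∈ closure (cobL π : Set V),
      MemM π (Smap π u) ∧ IsAdditiveMap (Smap π u) ∧ normG (Smap π u) = (0 : EReal)) ∧
    -- it is bijective onto `N_⊕`, with inverse `ψ ↦ ψ({1_G})`:
    (∀ ψ : FinG G → V, MemM π ψ → IsAdditiveMap ψ → normG ψ = (0 : EReal) →
      ψ ⟨{1}, Finset.singleton_nonempty 1⟩ ∈ closure (cobL π : Set V) ∧
      Smap π (ψ ⟨{1}, Finset.singleton_nonempty 1⟩) = ψ) ∧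
    (Function.Injective fun v : V => Smap π v) ∧
    -- it is continuous with continuous inverse:
    (∀ u : V, supNorm (Smap π u) ≤ C * ‖u‖) ∧
    (∀ ψ : FinG G → V, MemM π ψ → ‖ψ ⟨{1}, Finset.singleton_nonempty 1⟩‖ ≤ supNorm ψ) ∧
    -- the induced map `v + cl(L) ↦ S(v) + N_⊕` is well defined and injective:
    (∀ v w : V, v - w ∈ closure (cobL π : Set V) ↔ qMplusN π (Smap π v - Smap π w) = 0) ∧
    -- it is surjective onto `M_⊕/N_⊕`:
    (∀ ψ : FinG G → V, MemM π ψ → IsAdditiveMap ψ → ∃ v : V, Smap π v = ψ) ∧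
    -- it is continuous with continuous inverse:
    (∀ v : V, qMplusN π (Smap π v) ≤ C * qnorm (closure (cobL π : Set V)) v) ∧
    (∃ C' : ℝ, ∀ v : V, qnorm (closure (cobL π : Set V)) v ≤ C' * qMplusN π (Smap π v)) ∧
    -- `(M_⊕/N_⊕, |||·|||_{N_⊕})` is a Banach space: the quotient seminorm is a norm …
    (∀ ψ : FinG G → V, MemM π ψ → IsAdditiveMap ψ → qMplusN π ψ = 0 → normG ψ = (0 : EReal)) ∧
    -- … and the quotient is complete:
    (∀ ψ : ℕ → (FinG G → V), (∀ n, MemM π (ψ n) ∧ IsAdditiveMap (ψ n)) →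
      (∀ ε : ℝ, 0 < ε → ∃ N : ℕ, ∀ m ≥ N, ∀ n ≥ N, qMplusN π (ψ m - ψ n) < ε) →
      ∃ χ : FinG G → V, MemM π χ ∧ IsAdditiveMap χ ∧
        Filter.Tendsto (fun n => qMplusN π (ψ n - χ)) Filter.atTop (nhds (0 : ℝ))) := by
  refine ⟨fun u hu => ⟨memM_Smap hπ u, isAdditiveMap_Smap π u, normG_Smap_eq_zero hG hπ hu⟩,
    fun ψ hM hA hN => ?_, fun v w h => ?_, supNorm_Smap_le hπ,
    fun ψ hM => norm_apply_one_le_supNorm hM.1, fun v w => ?_,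
    fun ψ hM hA => ⟨_, Smap_apply_one_eq hM.2 hA⟩, qMplusN_Smap_le hG hπ,
    ⟨1, fun v => by simpa using qnorm_le_qMplusN_Smap hG hπ v⟩, fun ψ hM hA h => ?_,
    fun ψ hψ hcau => ?_⟩
  · have hS := Smap_apply_one_eq hM.2 hA
    exact ⟨mem_closure_of_normG_Smap_eq_zero hG (hS.symm ▸ hN), hS⟩
  · have h1 := congrFun h ⟨{1}, Finset.singleton_nonempty 1⟩
    simpa only [Smap, SF_singleton_one] using h1
  · rw [← Smap_sub, qMplusN_Smap_eq_zero_iff hG hπ]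
  · rw [← Smap_apply_one_eq hM.2 hA] at h ⊢
    exact normG_Smap_eq_zero hG hπ ((qMplusN_Smap_eq_zero_iff hG hπ _).mp h)
  · choose v hv using fun n => (⟨_, Smap_apply_one_eq (hψ n).1.2 (hψ n).2⟩ : ∃ v, Smap π v = ψ n)
    obtain rfl : (fun n => Smap π (v n)) = ψ := funext hv
    obtain ⟨w, hw⟩ := exists_tendsto_qMplusN hG hπ v hcau
    exact ⟨Smap π w, memM_Smap hπ w, isAdditiveMap_Smap π w, hw⟩
end

section
/- Let G be a countable discrete amenable group, (V,‖·‖) a complete semi-normed real vector space, π: G → Isom(V) a uniformly bounded representation, and W ⊆ V a subset. Then the set A(W) of set maps in M that are asymptotically additive relative to W is |||·|||_G-closed in M: if (φ_n)_n is a sequence in A(W) and φ ∈ M with |||φ_n − φ|||_G → 0, then φ ∈ A(W). Moreover, if W is convex, then A(W) is convex. -/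
open scoped Pointwise
open Filter

/-- `p F` holds for all sufficiently invariant nonempty finite sets `F`. -/
def EventuallyInv {G : Type*} [Group G] [DecidableEq G] (p : FinG G → Prop) : Prop :=
  ∃ (K : Finset G) (δ : ℝ), K.Nonempty ∧ 0 < δ ∧ ∀ F : FinG G, IsInv K δ F.1 → p F

theorem AF_smul_add_smul {G : Type*} [Group G] {V : Type*} [SeminormedAddCommGroup V]
    [NormedSpace ℝ V] {π : G →* (V ≃L[ℝ] V)} (F : Finset G) (a b : ℝ) (v w : V) :
    AF π F (a • v + b • w) = a • AF π F v + b • AF π F w := by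
  simp only [AF, SF, map_add, map_smul, Finset.sum_add_distrib, ← Finset.smul_sum, smul_add]
  rw [smul_comm a, smul_comm b]

section

variable {G : Type*} [Group G] [DecidableEq G]

theorem IsInv.mono_right {K F : Finset G} {δ ε : ℝ} (h : IsInv K δ F) (hδ : δ ≤ ε) :
    IsInv K ε F :=
  h.trans (mul_le_mul_of_nonneg_right hδ (Nat.cast_nonneg _))

theorem card_symmDiff_mul_le_two_mul {K L : Finset G} (hL : L.Nonempty) (hLK : L ⊆ K)
    (F : Finset G) : (symmDiff (L * F) F).card ≤ 2 * (symmDiff (K * F) F).card := by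
  have hcard : F.card ≤ (L * F).card := Finset.card_le_card_mul_left hL
  have hsub : (L * F) \ F ⊆ symmDiff (K * F) F := by
    intro x hx
    rw [Finset.mem_sdiff] at hx
    exact Finset.mem_symmDiff.2 (Or.inl ⟨Finset.mul_subset_mul_right hLK hx.1, hx.2⟩)
  have hsplit : (symmDiff (L * F) F).card ≤ ((L * F) \ F).card + (F \ (L * F)).card :=
    Finset.card_union_le _ _
  have hle := Finset.card_le_card hsub
  have h₁ := Finset.card_sdiff_add_card_inter (L * F) F
  have h₂ := Finset.card_sdiff_add_card_inter F (L * F)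
  rw [Finset.inter_comm] at h₂
  omega

/-- Passing to a nonempty subset of `K` costs at most a factor `2` in the invariance constant. -/
theorem IsInv.subset {K L F : Finset G} {δ : ℝ} (h : IsInv K (δ / 2) F) (hL : L.Nonempty)
    (hLK : L ⊆ K) : IsInv L δ F := by
  have hle : ((symmDiff (L * F) F).card : ℝ) ≤ 2 * (symmDiff (K * F) F).card := by
    exact_mod_cast card_symmDiff_mul_le_two_mul hL hLK F
  unfold IsInv at h ⊢
  linarith

theorem EventuallyInv.and {p q : FinG G → Prop} (hp : EventuallyInv p) (hq : EventuallyInv q) :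
    EventuallyInv fun F => p F ∧ q F := by
  obtain ⟨K, δ, hK, hδ, hp⟩ := hp
  obtain ⟨L, ε, hL, hε, hq⟩ := hq
  refine ⟨K ∪ L, min δ ε / 2, hK.inl, half_pos (lt_min hδ hε), fun F hF => ⟨hp F ?_, hq F ?_⟩⟩
  · exact (hF.subset hK Finset.subset_union_left).mono_right (min_le_left _ _)
  · exact (hF.subset hL Finset.subset_union_right).mono_right (min_le_right _ _)

theorem EventuallyInv.mono {p q : FinG G → Prop} (hp : EventuallyInv p) (h : ∀ F, p F → q F) :
    EventuallyInv q := by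
  obtain ⟨K, δ, hK, hδ, hp⟩ := hp
  exact ⟨K, δ, hK, hδ, fun F hF => h F (hp F hF)⟩

theorem eventuallyInv_lt_of_limsupG_lt {f : FinG G → ℝ} {c : ℝ} (h : limsupG f < c) :
    EventuallyInv fun F => f F < c := by
  simp only [limsupG, iInf_lt_iff] at h
  obtain ⟨K, δ, h⟩ := h
  refine ⟨K.1, δ.1, K.2, δ.2, fun F hF => ?_⟩
  have hle := le_iSup (fun F : {F : FinG G // IsInv K.1 δ.1 F.1} => (f F.1 : EReal)) ⟨F, hF⟩
  exact EReal.coe_lt_coe_iff.1 (hle.trans_lt h)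

theorem limsupG_le_of_eventuallyInv {f : FinG G → ℝ} {c : ℝ}
    (h : EventuallyInv fun F => f F ≤ c) : limsupG f ≤ c := by
  obtain ⟨K, δ, hK, hδ, h⟩ := h
  exact (iInf₂_le (⟨K, hK⟩ : {K : Finset G // K.Nonempty}) (⟨δ, hδ⟩ : {d : ℝ // 0 < d})).trans
    (iSup_le fun F => EReal.coe_le_coe_iff.2 (h F.1 F.2))

theorem AmenableG.limsupG_nonneg (hG : AmenableG G) {f : FinG G → ℝ} (hf : ∀ F, 0 ≤ f F) :
    0 ≤ limsupG f := by
  refine le_iInf₂ fun K δ => ?_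
  obtain ⟨F, hF, hinv⟩ := hG K.1 K.2 δ.1 δ.2
  have hle := le_iSup (fun F : {F : FinG G // IsInv K.1 δ.1 F.1} => (f F.1 : EReal))
    ⟨⟨F, hF⟩, hinv⟩
  exact le_trans (EReal.coe_le_coe_iff.2 (hf ⟨F, hF⟩)) hle

variable {V : Type*} [SeminormedAddCommGroup V] [NormedSpace ℝ V] {π : G →* (V ≃L[ℝ] V)}

theorem asympAddRel_iff (hG : AmenableG G) {W : Set V} {φ : FinG G → V} :
    AsympAddRel π W φ ↔ ∀ ε : ℝ, 0 < ε → ∃ w ∈ W,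
      EventuallyInv fun F => ‖(F.1.card : ℝ)⁻¹ • φ F - AF π F.1 w‖ < ε := by
  constructor
  · intro h ε hε
    have hlt : (0 : EReal) < (ε : EReal) := by exact_mod_cast hε
    rw [← (show _ = (0 : EReal) from h), iInf_lt_iff] at hlt
    obtain ⟨w, hw⟩ := hlt
    exact ⟨w.1, w.2, eventuallyInv_lt_of_limsupG_lt hw⟩
  · intro h
    refine le_antisymm (EReal.le_of_forall_lt_iff_le.1 fun ε hε => ?_)
      (le_iInf fun w => hG.limsupG_nonneg fun F => norm_nonneg _)
    obtain ⟨w, hw, hev⟩ := h ε (by exact_mod_cast hε)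
    exact (iInf_le _ (⟨w, hw⟩ : W)).trans
      (limsupG_le_of_eventuallyInv (hev.mono fun F hF => hF.le))

theorem MemM.smul_add_smul {φ ψ : FinG G → V} (hφ : MemM π φ) (hψ : MemM π ψ) (a b : ℝ) :
    MemM π (a • φ + b • ψ) := by
  obtain ⟨⟨A, hA⟩, hφ⟩ := hφ
  obtain ⟨⟨B, hB⟩, hψ⟩ := hψ
  refine ⟨⟨‖a‖ * A + ‖b‖ * B, fun F => ?_⟩, fun g F => ?_⟩
  · calc ‖a • φ F + b • ψ F‖ ≤ ‖a‖ * ‖φ F‖ + ‖b‖ * ‖ψ F‖ := by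
          simpa only [norm_smul] using norm_add_le (a • φ F) (b • ψ F)
      _ ≤ ‖a‖ * (A * F.1.card) + ‖b‖ * (B * F.1.card) := by
          gcongr
          exacts [hA F, hB F]
      _ = _ := by ring
  · simp [← hφ g F, ← hψ g F]

theorem asympAddRel_of_tendsto_normG (hG : AmenableG G) {W : Set V} {φ : ℕ → FinG G → V}
    {ψ : FinG G → V} (hφ : ∀ n, AsympAddRel π W (φ n))
    (hlim : Tendsto (fun n => normG (φ n - ψ)) atTop (nhds (0 : EReal))) :
    AsympAddRel π W ψ := by
  refine (asympAddRel_iff hG).2 fun ε hε => ?_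
  have hpos : (0 : EReal) < ((ε / 2 : ℝ) : EReal) := by exact_mod_cast half_pos hε
  obtain ⟨n, hn⟩ := (hlim.eventually_lt_const hpos).exists
  obtain ⟨w, hw, hev⟩ := (asympAddRel_iff hG).1 (hφ n) (ε / 2) (half_pos hε)
  refine ⟨w, hw, (hev.and (eventuallyInv_lt_of_limsupG_lt hn)).mono fun F ⟨h₁, h₂⟩ => ?_⟩
  have hnorm : ‖(F.1.card : ℝ)⁻¹ • (φ n - ψ) F‖ < ε / 2 := by
    rwa [norm_smul, norm_inv, Real.norm_natCast, inv_mul_eq_div]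
  calc ‖(F.1.card : ℝ)⁻¹ • ψ F - AF π F.1 w‖
      = ‖((F.1.card : ℝ)⁻¹ • φ n F - AF π F.1 w) - (F.1.card : ℝ)⁻¹ • (φ n - ψ) F‖ := by
        rw [Pi.sub_apply, smul_sub]
        congr 1
        abel
    _ ≤ _ := norm_sub_le _ _
    _ < ε := by linarith

theorem AsympAddRel.smul_add_smul (hG : AmenableG G) {W : Set V} (hW : Convex ℝ W)
    {φ ψ : FinG G → V} (hφ : AsympAddRel π W φ) (hψ : AsympAddRel π W ψ) {a b : ℝ}
    (ha : 0 ≤ a) (hb : 0 ≤ b) (hab : a + b = 1) : AsympAddRel π W (a • φ + b • ψ) := by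
  refine (asympAddRel_iff hG).2 fun ε hε => ?_
  obtain ⟨v, hv, hφ⟩ := (asympAddRel_iff hG).1 hφ (ε / 2) (half_pos hε)
  obtain ⟨w, hw, hψ⟩ := (asympAddRel_iff hG).1 hψ (ε / 2) (half_pos hε)
  refine ⟨a • v + b • w, hW hv hw ha hb hab, (hφ.and hψ).mono fun F ⟨h₁, h₂⟩ => ?_⟩
  set x := (F.1.card : ℝ)⁻¹ • φ F - AF π F.1 v
  set y := (F.1.card : ℝ)⁻¹ • ψ F - AF π F.1 w
  calc ‖(F.1.card : ℝ)⁻¹ • (a • φ + b • ψ) F - AF π F.1 (a • v + b • w)‖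
      = ‖a • x + b • y‖ := by
        simp only [x, y, AF_smul_add_smul, Pi.add_apply, Pi.smul_apply, smul_add, smul_sub,
          smul_comm _ (F.1.card : ℝ)⁻¹]
        congr 1
        abel
    _ ≤ a * ‖x‖ + b * ‖y‖ := by
        simpa only [norm_smul, Real.norm_of_nonneg ha, Real.norm_of_nonneg hb] using
          norm_add_le (a • x) (b • y)
    _ ≤ a * (ε / 2) + b * (ε / 2) := by gcongr
    _ < ε := by rw [← add_mul, hab]; linarith

end

theorem statement18 {G : Type*} [Group G] [DecidableEq G] [Countable G]
    {V : Type*} [SeminormedAddCommGroup V] [NormedSpace ℝ V] [CompleteSpace V]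
    (hG : AmenableG G) (π : G →* (V ≃L[ℝ] V)) (C : ℝ) (hπ : UnifBdd π C)
    (W : Set V) :
    -- `A(W)` is `|||·|||_G`-closed in `M`:
    (∀ φ : ℕ → (FinG G → V), (∀ n, MemM π (φ n) ∧ AsympAddRel π W (φ n)) →
      ∀ ψ : FinG G → V, MemM π ψ →
        Filter.Tendsto (fun n => normG (φ n - ψ)) Filter.atTop (nhds (0 : EReal)) →
        AsympAddRel π W ψ) ∧
    -- if `W` is convex then `A(W)` is convex:
    (Convex ℝ W →
      ∀ φ ψ : FinG G → V, MemM π φ ∧ AsympAddRel π W φ → MemM π ψ ∧ AsympAddRel π W ψ →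
        ∀ t : ℝ, 0 ≤ t → t ≤ 1 →
          MemM π (t • φ + (1 - t) • ψ) ∧ AsympAddRel π W (t • φ + (1 - t) • ψ)) := by
  exact ⟨fun φ hφ ψ _ hlim => asympAddRel_of_tendsto_normG hG (fun n => (hφ n).2) hlim,
    fun hW φ ψ hφ hψ t ht ht' => ⟨hφ.1.smul_add_smul hψ.1 t (1 - t),
      hφ.2.smul_add_smul hG hW hψ.2 ht (sub_nonneg.2 ht') (add_sub_cancel t 1)⟩⟩
end
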